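/- arXiv:1302.3037 — 2 statements merged into one kernel-verified Lean document; each statement's English description precedes it below -/
import Mathlib

section
/- Let b ∈ ℕ and let m = (m₁,…,m_k) be a tuple of natural numbers, and suppose that for every p ∈ ℕ there exists some v with ⟨b,p,m,v⟩ ∈ Comp (totality of the index b on arguments (p,m)). Then there is exactly one r with ⟨⟨3,k,b⟩,m,r⟩ ∈ Comp; moreover, if ⟨b,p,m,0⟩ ∉ Comp for every p then r = 0, and if p₀ is the least p with ⟨b,p,m,0⟩ ∈ Comp then r = p₀ + 1. -/
/-- The tuple coding `⟨m₁,…,m_k⟩ := p₁^{m₁+1} ⋯ p_k^{m_k+1}` (`p_i` the `i`-th prime),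
with `⟨⟩ = 1`. -/
noncomputable def code (l : List ℕ) : ℕ :=
  ∏ i ∈ Finset.range l.length, (Nat.nth Nat.Prime i) ^ (l.getD i 0 + 1)

/-- `CompClosed Sb0 X` says that the set `X ⊆ ℕ` is closed under the clauses of
Definition 4.1 (recursion in the type-2 functional `E`), relative to a fixed
S-m-n substitution function `Sb0`. -/
def CompClosed (Sb0 : ℕ → ℕ → ℕ) (X : Set ℕ) : Prop :=
  (∀ (k n : ℕ) (m : List ℕ), m.length = k →
      code (code [0, k, 0, n] :: m ++ [n]) ∈ X) ∧
  (∀ (k i : ℕ) (m : List ℕ), m.length = k → i < k →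
      code (code [0, k, 1, i] :: m ++ [m.getD i 0]) ∈ X) ∧
  (∀ (k i : ℕ) (m : List ℕ), m.length = k → i < k →
      code (code [0, k, 2, i] :: m ++ [m.getD i 0 + 1]) ∈ X) ∧
  (∀ (k p q r s : ℕ) (m : List ℕ), m.length = k → r = s →
      code (code [0, k + 3, 4] :: p :: q :: r :: s :: m ++ [p]) ∈ X) ∧
  (∀ (k p q r s : ℕ) (m : List ℕ), m.length = k → r ≠ s →
      code (code [0, k + 3, 4] :: p :: q :: r :: s :: m ++ [q]) ∈ X) ∧
  (∀ (k p q : ℕ) (m : List ℕ), m.length = k →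
      code (code [0, k + 2, 5] :: p :: q :: m ++ [Sb0 p q]) ∈ X) ∧
  (∀ (k k' b n : ℕ) (m c q : List ℕ), m.length = k → c.length = k' → q.length = k' →
      (∀ i < k', code (c.getD i 0 :: m ++ [q.getD i 0]) ∈ X) →
      code (b :: q ++ [n]) ∈ X →
      code (code ([1, k, b] ++ c) :: m ++ [n]) ∈ X) ∧
  (∀ (k b n : ℕ) (m : List ℕ), m.length = k →
      code (b :: m ++ [n]) ∈ X →
      code (code [2, k + 1] :: b :: m ++ [n]) ∈ X) ∧
  (∀ (k b : ℕ) (m : List ℕ), m.length = k →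
      (∀ p : ℕ, ∃ kp : ℕ, 0 < kp ∧ code (b :: p :: m ++ [kp]) ∈ X) →
      code (code [3, k, b] :: m ++ [0]) ∈ X) ∧
  (∀ (k b p : ℕ) (m : List ℕ), m.length = k →
      code (b :: p :: m ++ [0]) ∈ X →
      (∀ i < p, ∃ ki : ℕ, 0 < ki ∧ code (b :: i :: m ++ [ki]) ∈ X) →
      code (code [3, k, b] :: m ++ [p + 1]) ∈ X)

/-- `Comp Sb0` is the smallest set closed under the clauses of Definition 4.1. -/
def Comp (Sb0 : ℕ → ℕ → ℕ) : Set ℕ :=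
  {u : ℕ | ∀ X : Set ℕ, CompClosed Sb0 X → u ∈ X}

theorem code_ne_zero (l : List ℕ) : code l ≠ 0 := by
  unfold code
  refine Finset.prod_ne_zero_iff.mpr fun i _ => ?_
  exact pow_ne_zero _ (Nat.prime_nth_prime i).ne_zero

theorem code_factorization (l : List ℕ) (j : ℕ) :
    (code l).factorization (Nat.nth Nat.Prime j) = if j < l.length then l.getD j 0 + 1 else 0 := by
  unfold code
  rw [Nat.factorization_prod (fun i _ => pow_ne_zero _ (Nat.prime_nth_prime i).ne_zero)]
  rw [Finsupp.finsetSum_apply]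
  have hterm : ∀ i, ((Nat.nth Nat.Prime i) ^ (l.getD i 0 + 1)).factorization (Nat.nth Nat.Prime j)
      = if j = i then l.getD i 0 + 1 else 0 := by
    intro i
    rw [(Nat.prime_nth_prime i).factorization_pow, Finsupp.single_apply]
    have hinj := (Nat.nth_injective Nat.infinite_setOf_prime).eq_iff (a := i) (b := j)
    by_cases h : j = i
    · subst h; simp
    · rw [if_neg h, if_neg]
      intro h'
      exact h (hinj.mp h').symm
  simp only [hterm]
  simp [Finset.sum_ite_eq]

theorem code_injective {l l' : List ℕ} (h : code l = code l') : l = l' := by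
  have key : ∀ j, (if j < l.length then l.getD j 0 + 1 else 0)
      = if j < l'.length then l'.getD j 0 + 1 else 0 := by
    intro j
    rw [← code_factorization, ← code_factorization, h]
  have hlen : l.length = l'.length := by
    have h1 := key l.length
    have h2 := key l'.length
    by_contra hne
    rcases lt_or_gt_of_ne hne with hlt | hlt
    · simp [hlt] at h1
    · simp [hlt] at h2
  refine List.ext_getElem hlen fun i h1 h2 => ?_
  have := key i
  rw [if_pos h1, if_pos h2, List.getD_eq_getElem _ _ h1, List.getD_eq_getElem _ _ h2] at this
  omega

theorem code_inj {l l' : List ℕ} : code l = code l' ↔ l = l' :=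
  ⟨code_injective, fun h => h ▸ rfl⟩

/-- The computation relation: index, arguments, value. -/
inductive C (Sb0 : ℕ → ℕ → ℕ) : ℕ → List ℕ → ℕ → Prop
  | const (e n : ℕ) (m : List ℕ) (he : e = code [0, m.length, 0, n]) : C Sb0 e m n
  | proj (e i n : ℕ) (m : List ℕ) (he : e = code [0, m.length, 1, i]) (hi : i < m.length)
      (hn : n = m.getD i 0) : C Sb0 e m n
  | succ (e i n : ℕ) (m : List ℕ) (he : e = code [0, m.length, 2, i]) (hi : i < m.length)
      (hn : n = m.getD i 0 + 1) : C Sb0 e m n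
  | eq (e p q r s n : ℕ) (a m : List ℕ) (he : e = code [0, m.length + 3, 4])
      (ha : a = p :: q :: r :: s :: m) (hn : n = if r = s then p else q) : C Sb0 e a n
  | subst (e p q n : ℕ) (a m : List ℕ) (he : e = code [0, m.length + 2, 5])
      (ha : a = p :: q :: m) (hn : n = Sb0 p q) : C Sb0 e a n
  | comp (e b n : ℕ) (m c q : List ℕ) (he : e = code ([1, m.length, b] ++ c))
      (hq : q.length = c.length)
      (hc : ∀ i < c.length, C Sb0 (c.getD i 0) m (q.getD i 0))
      (hb : C Sb0 b q n) : C Sb0 e m n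
  | univ (e b n : ℕ) (a m : List ℕ) (he : e = code [2, m.length + 1]) (ha : a = b :: m)
      (hb : C Sb0 b m n) : C Sb0 e a n
  | none (e b n : ℕ) (m : List ℕ) (f : ℕ → ℕ) (he : e = code [3, m.length, b]) (hn : n = 0)
      (hf : ∀ p, C Sb0 b (p :: m) (f p + 1)) : C Sb0 e m n
  | least (e b p n : ℕ) (m : List ℕ) (f : ℕ → ℕ) (he : e = code [3, m.length, b])
      (hn : n = p + 1) (hp : C Sb0 b (p :: m) 0)
      (hf : ∀ i < p, C Sb0 b (i :: m) (f i + 1)) : C Sb0 e m n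

theorem C.toComp {Sb0 : ℕ → ℕ → ℕ} {e : ℕ} {m : List ℕ} {n : ℕ} (h : C Sb0 e m n) :
    code (e :: m ++ [n]) ∈ Comp Sb0 := by
  intro X hX
  obtain ⟨h1, h2, h3, h4, h5, h6, h7, h8, h9, h10⟩ := hX
  induction h with
  | const e n m he => subst he; exact h1 _ _ _ rfl
  | proj e i n m he hi hn => subst he hn; exact h2 _ _ _ rfl hi
  | succ e i n m he hi hn => subst he hn; exact h3 _ _ _ rfl hi
  | eq e p q r s n a m he ha hn =>
    subst he ha hn
    split_ifs with h
    · exact h4 _ _ _ _ _ _ rfl h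
    · exact h5 _ _ _ _ _ _ rfl h
  | subst e p q n a m he ha hn => subst he ha hn; exact h6 _ _ _ _ rfl
  | comp e b n m c q he hq hc hb ihc ihb => subst he; exact h7 _ _ _ _ _ _ q rfl rfl hq ihc ihb
  | univ e b n a m he ha hb ihb => subst he ha; exact h8 _ _ _ _ rfl ihb
  | none e b n m f he hn hf ih =>
    subst he hn; exact h9 _ _ _ rfl fun p => ⟨_, Nat.succ_pos _, ih p⟩
  | least e b p n m f he hn hp hf ihp ih =>
    subst he hn; exact h10 _ _ _ _ rfl ihp fun p hp => ⟨_, Nat.succ_pos _, ih p hp⟩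

theorem C.of_code {Sb0 : ℕ → ℕ → ℕ} {e : ℕ} {m : List ℕ} {n : ℕ}
    (h : ∃ e' m' n', code (e :: m ++ [n]) = code (e' :: m' ++ [n']) ∧ C Sb0 e' m' n') :
    C Sb0 e m n := by
  obtain ⟨e', m', n', h, hC⟩ := h
  have h' := code_injective h
  simp only [List.cons_append, List.cons.injEq] at h'
  obtain ⟨rfl, h'⟩ := h'
  obtain ⟨rfl, h''⟩ := List.append_inj' h' rfl
  simp only [List.cons.injEq, and_true] at h''
  exact h'' ▸ hC

theorem C.ofComp {Sb0 : ℕ → ℕ → ℕ} {e : ℕ} {m : List ℕ} {n : ℕ}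
    (h : code (e :: m ++ [n]) ∈ Comp Sb0) : C Sb0 e m n := by
  refine C.of_code (h {u | ∃ e' m' n', u = code (e' :: m' ++ [n']) ∧ C Sb0 e' m' n'} ?_)
  refine ⟨?_, ?_, ?_, ?_, ?_, ?_, ?_, ?_, ?_, ?_⟩
  · rintro k n m rfl
    exact ⟨_, _, _, rfl, .const _ _ _ rfl⟩
  · rintro k i m rfl hi
    exact ⟨_, _, _, rfl, .proj _ _ _ _ rfl hi rfl⟩
  · rintro k i m rfl hi
    exact ⟨_, _, _, rfl, .succ _ _ _ _ rfl hi rfl⟩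
  · rintro k p q r s m rfl hi
    exact ⟨_, p :: q :: r :: s :: m, _, rfl, .eq _ _ _ _ _ _ _ _ rfl rfl (by simp [hi])⟩
  · rintro k p q r s m rfl hi
    exact ⟨_, p :: q :: r :: s :: m, _, rfl, .eq _ _ _ _ _ _ _ _ rfl rfl (by simp [hi])⟩
  · rintro k p q m rfl
    exact ⟨_, p :: q :: m, _, rfl, .subst _ _ _ _ _ _ rfl rfl rfl⟩
  · rintro k k' b n m c q rfl rfl hq hc hb
    exact ⟨_, _, _, rfl, .comp _ _ _ _ c q rfl hq (fun i hi => C.of_code (hc i hi))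
      (C.of_code hb)⟩
  · rintro k b n m rfl hb
    exact ⟨_, b :: m, _, rfl, .univ _ _ _ _ _ rfl rfl (C.of_code hb)⟩
  · rintro k b m rfl hf
    choose f hpos hf using hf
    refine ⟨_, _, _, rfl, .none _ b _ _ (fun p => f p - 1) rfl rfl fun p => ?_⟩
    rw [Nat.sub_add_cancel (hpos p)]
    exact C.of_code (m := p :: m) (hf p)
  · rintro k b p m rfl hp hf
    choose! f hf using hf
    refine ⟨_, _, _, rfl, .least _ b p _ _ (fun p => f p - 1) rfl rfl
      (C.of_code (m := p :: m) hp) fun i hi => ?_⟩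
    rw [Nat.sub_add_cancel (hf i hi).1]
    exact C.of_code (m := i :: m) (hf i hi).2

/-- Determinism (Lemma 4.2). -/
theorem C.det {Sb0 : ℕ → ℕ → ℕ} {e : ℕ} {m : List ℕ} {n : ℕ} (h : C Sb0 e m n) :
    ∀ n', C Sb0 e m n' → n = n' := by
  induction h with
  | comp e b n m c q he hq hc hb ihc ihb =>
    intro n' h'
    cases h' with
    | comp _ b' _ _ c' q' he' hq' hc' hb' =>
      subst he
      simp [code_inj] at he'
      obtain ⟨rfl, rfl⟩ := he'
      have hqq : q = q' := by
        refine List.ext_getElem (hq.trans hq'.symm) fun i h1 h2 => ?_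
        have := ihc i (hq ▸ h1) _ (hc' i (hq ▸ h1))
        rwa [List.getD_eq_getElem _ _ h1, List.getD_eq_getElem _ _ h2] at this
      subst hqq
      exact ihb _ hb'
    | _ => simp_all [code_inj]
  | univ e b n a m he ha hb ihb =>
    intro n' h'
    cases h' with
    | univ _ b' _ _ m' he' ha' hb' =>
      rw [ha] at ha'
      obtain ⟨rfl, rfl⟩ := List.cons.inj ha'
      exact ihb _ hb'
    | _ => simp_all [code_inj]
  | none e b n m f he hn hf ih =>
    intro n' h'
    cases h' with
    | none => simp_all
    | least _ b' p _ _ g he' hn' hp' hf' =>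
      subst he
      simp [code_inj] at he'
      subst he'
      have := ih p _ hp'
      omega
    | _ => simp_all [code_inj]
  | least e b p n m f he hn hp hf ihp ih =>
    intro n' h'
    cases h' with
    | none _ b' _ _ g he' hn' hf' =>
      subst he
      simp [code_inj] at he'
      subst he'
      have := ihp _ (hf' p)
      omega
    | least _ b' p' _ _ g he' hn' hp' hf' =>
      subst he
      simp [code_inj] at he'
      subst he'
      rcases lt_trichotomy p p' with hlt | heq | hlt
      · have := ihp _ (hf' p hlt)
        omega
      · omega
      · have := ih p' hlt _ hp'
        omega
    | _ => simp_all [code_inj]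
  | _ =>
    intro n' h'
    cases h' <;> simp_all [code_inj]

theorem comp_iff {Sb0 : ℕ → ℕ → ℕ} {e : ℕ} {m : List ℕ} {n : ℕ} :
    code (e :: m ++ [n]) ∈ Comp Sb0 ↔ C Sb0 e m n := ⟨C.ofComp, C.toComp⟩

theorem comp_iff_cons {Sb0 : ℕ → ℕ → ℕ} {e p : ℕ} {m : List ℕ} {n : ℕ} :
    code (e :: p :: m ++ [n]) ∈ Comp Sb0 ↔ C Sb0 e (p :: m) n := comp_iff (m := p :: m)

/-- Correctness of the `E`-search operator `⟨3,k,b⟩`: if the index `b` is total on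
arguments `(p, m)`, then there is exactly one `r` with `⟨⟨3,k,b⟩, m, r⟩ ∈ Comp`;
moreover `r = 0` if `⟨b, p, m, 0⟩ ∉ Comp` for every `p`, and `r = p₀ + 1` if `p₀`
is the least `p` with `⟨b, p, m, 0⟩ ∈ Comp`. -/
theorem e_search_correct (Sb0 : ℕ → ℕ → ℕ) (b k : ℕ) (m : List ℕ) (hm : m.length = k)
    (htot : ∀ p : ℕ, ∃ v : ℕ, code (b :: p :: m ++ [v]) ∈ Comp Sb0) :
    (∃! r : ℕ, code (code [3, k, b] :: m ++ [r]) ∈ Comp Sb0) ∧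
    (∀ r : ℕ, code (code [3, k, b] :: m ++ [r]) ∈ Comp Sb0 →
      ((∀ p : ℕ, code (b :: p :: m ++ [0]) ∉ Comp Sb0) → r = 0) ∧
      (∀ p₀ : ℕ, code (b :: p₀ :: m ++ [0]) ∈ Comp Sb0 →
        (∀ q < p₀, code (b :: q :: m ++ [0]) ∉ Comp Sb0) → r = p₀ + 1)) := by
  classical
  subst hm
  simp only [comp_iff_cons] at htot ⊢
  simp only [comp_iff]
  choose v hv using htot
  have hnone : (∀ p, ¬ C Sb0 b (p :: m) 0) → C Sb0 (code [3, m.length, b]) m 0 := by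
    intro h
    refine .none _ b _ _ (fun p => v p - 1) rfl rfl fun p => ?_
    have hp : v p ≠ 0 := fun h0 => h p (h0 ▸ hv p)
    rw [Nat.sub_add_cancel (Nat.pos_of_ne_zero hp)]
    exact hv p
  have hleast : ∀ p₀, C Sb0 b (p₀ :: m) 0 → (∀ q < p₀, ¬ C Sb0 b (q :: m) 0) →
      C Sb0 (code [3, m.length, b]) m (p₀ + 1) := by
    intro p₀ h0 h
    refine .least _ b p₀ _ _ (fun p => v p - 1) rfl rfl h0 fun p hlt => ?_
    have hp : v p ≠ 0 := fun h0 => h p hlt (h0 ▸ hv p)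
    rw [Nat.sub_add_cancel (Nat.pos_of_ne_zero hp)]
    exact hv p
  refine ⟨?_, fun r hr => ⟨fun h => hr.det _ (hnone h), fun p₀ h0 h => hr.det _ (hleast p₀ h0 h)⟩⟩
  by_cases hex : ∃ p, C Sb0 b (p :: m) 0
  · have := hleast (Nat.find hex) (Nat.find_spec hex) fun q hq => Nat.find_min hex hq
    exact ⟨_, this, fun r hr => hr.det _ this⟩
  · have := hnone (not_exists.mp hex)
    exact ⟨_, this, fun r hr => hr.det _ this⟩
end

section
/- For every n with n ∈ U and every x ∈ ℕ: x E n holds if and only if x NE n fails; that is, elementhood and non-elementhood in any type of U are complementary. -/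
/-- The pairing function `(n, m) := (n + m)² + n + 1`. -/
def pair (n m : ℕ) : ℕ := (n + m) ^ 2 + n + 1

/-- `n_ℕ := (0, n)`, the code of the finite type with `n` elements. -/
def nNat (n : ℕ) : ℕ := pair 0 n

/-- `nat := (1, 0)`, the code of the type of natural numbers. -/
def natt : ℕ := pair 1 0

/-- `pl(n, m) := (2, (n, m))`, the code of a sum type. -/
def plT (n m : ℕ) : ℕ := pair 2 (pair n m)

/-- `σ(n, e) := (3, (n, e))`, the code of a dependent sum type. -/
def sigT (n e : ℕ) : ℕ := pair 3 (pair n e)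

/-- `π(n, e) := (4, (n, e))`, the code of a dependent product type. -/
def piT (n e : ℕ) : ℕ := pair 4 (pair n e)

/-- `sup(n, e) := (5, (n, e))`, the code of a well-founded tree. -/
def supT (n e : ℕ) : ℕ := pair 5 (pair n e)

/-- `{e}^E(k) ≃ x`, i.e. `⟨e, k, x⟩ ∈ Comp`. -/
def app (Sb0 : ℕ → ℕ → ℕ) (e k x : ℕ) : Prop := code [e, k, x] ∈ Comp Sb0

/-- A family of predicates: candidate interpretations for the type predicate `U`,
the elementhood predicate `E`, the non-elementhood predicate `NE`, and the
predicate `V` of codes of well-founded trees over `U`. -/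
structure TyFam where
  U : ℕ → Prop
  E : ℕ → ℕ → Prop
  NE : ℕ → ℕ → Prop
  V : ℕ → Prop

/-- `TyClosed Sb0 F` says the family `F` is closed under the clauses of
Definition 5.2 defining the types `U`, elementhood `E`, non-elementhood `NE`
and the class `V` of well-founded trees. -/
def TyClosed (Sb0 : ℕ → ℕ → ℕ) (F : TyFam) : Prop :=
  (∀ n : ℕ, F.U (nNat n)) ∧
  (∀ k n : ℕ, k < n → F.E k (nNat n)) ∧
  (∀ k n : ℕ, n ≤ k → F.NE k (nNat n)) ∧
  F.U natt ∧
  (∀ n : ℕ, F.E n natt) ∧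
  (∀ n m : ℕ, F.U n → F.U m → F.U (plT n m)) ∧
  (∀ n m k : ℕ, F.U (plT n m) → F.E k n → F.E (pair 0 k) (plT n m)) ∧
  (∀ n m k : ℕ, F.U (plT n m) → F.E k m → F.E (pair 1 k) (plT n m)) ∧
  (∀ n m k : ℕ, F.U (plT n m) → F.NE k n → F.NE (pair 0 k) (plT n m)) ∧
  (∀ n m k : ℕ, F.U (plT n m) → F.NE k m → F.NE (pair 1 k) (plT n m)) ∧
  (∀ n m k : ℕ, F.U (plT n m) → (∀ x : ℕ, k ≠ pair 0 x ∧ k ≠ pair 1 x) →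
      F.NE k (plT n m)) ∧
  (∀ n e : ℕ, F.U n → (∀ k : ℕ, F.NE k n ∨ ∃ x : ℕ, app Sb0 e k x ∧ F.U x) →
      F.U (sigT n e)) ∧
  (∀ n e k u x : ℕ, F.U (sigT n e) → F.E k n → app Sb0 e k x → F.E u x →
      F.E (pair k u) (sigT n e)) ∧
  (∀ n e k u : ℕ, F.U (sigT n e) → F.NE k n → F.NE (pair k u) (sigT n e)) ∧
  (∀ n e k u x : ℕ, F.U (sigT n e) → app Sb0 e k x → F.NE u x →
      F.NE (pair k u) (sigT n e)) ∧
  (∀ n e z : ℕ, F.U (sigT n e) → (∀ u v : ℕ, z ≠ pair u v) → F.NE z (sigT n e)) ∧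
  (∀ n e : ℕ, F.U n → (∀ k : ℕ, F.NE k n ∨ ∃ x : ℕ, app Sb0 e k x ∧ F.U x) →
      F.U (piT n e)) ∧
  (∀ n e d : ℕ, F.U (piT n e) →
      (∀ k : ℕ, F.NE k n ∨ ∃ x y : ℕ, app Sb0 e k x ∧ app Sb0 d k y ∧ F.E y x) →
      F.E d (piT n e)) ∧
  (∀ n e d u : ℕ, F.U (piT n e) → F.E u n → (∀ z : ℕ, ¬ app Sb0 d u z) →
      F.NE d (piT n e)) ∧
  (∀ n e d u x z : ℕ, F.U (piT n e) → F.E u n → app Sb0 e u x → app Sb0 d u z →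
      F.NE z x → F.NE d (piT n e)) ∧
  (∀ n e : ℕ, F.U n → (∀ k : ℕ, F.NE k n ∨ ∃ x : ℕ, app Sb0 e k x ∧ F.V x) →
      F.V (supT n e))

/-- The type predicate `U`: smallest family closed under the clauses of Definition 5.2. -/
def UU (Sb0 : ℕ → ℕ → ℕ) (n : ℕ) : Prop := ∀ F : TyFam, TyClosed Sb0 F → F.U n

/-- The elementhood predicate `k E n` of Definition 5.2. -/
def EE (Sb0 : ℕ → ℕ → ℕ) (k n : ℕ) : Prop := ∀ F : TyFam, TyClosed Sb0 F → F.E k n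

/-- The non-elementhood predicate `k NE n` of Definition 5.2. -/
def NEE (Sb0 : ℕ → ℕ → ℕ) (k n : ℕ) : Prop := ∀ F : TyFam, TyClosed Sb0 F → F.NE k n

/-- The predicate `V` of codes of well-founded trees over `U` of Definition 5.2. -/
def VV (Sb0 : ℕ → ℕ → ℕ) (n : ℕ) : Prop := ∀ F : TyFam, TyClosed Sb0 F → F.V n


theorem pair_inj_iff (a b c d : ℕ) : pair a b = pair c d ↔ a = c ∧ b = d := by
  constructor
  · intro h
    unfold pair at h
    have hs : a + b = c + d := by
      rcases lt_trichotomy (a + b) (c + d) with h1 | h1 | h1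
      · nlinarith
      · exact h1
      · nlinarith
    rw [hs] at h
    omega
  · rintro ⟨rfl, rfl⟩
    rfl

theorem code_fact (l : List ℕ) (i : ℕ) :
    (code l).factorization (Nat.nth Nat.Prime i) =
      if i < l.length then l.getD i 0 + 1 else 0 := by
  have hp : ∀ j, (Nat.nth Nat.Prime j).Prime := fun j => Nat.prime_nth_prime j
  unfold code
  rw [Nat.factorization_prod_apply (fun j _ => pow_ne_zero _ (hp j).ne_zero)]
  have : ∀ j ∈ Finset.range l.length,
      (Nat.nth Nat.Prime j ^ (l.getD j 0 + 1)).factorization (Nat.nth Nat.Prime i) =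
      if j = i then l.getD i 0 + 1 else 0 := by
    intro j _
    rw [(hp j).factorization_pow, Finsupp.single_apply]
    by_cases hji : j = i
    · subst hji; simp
    · have : Nat.nth Nat.Prime j ≠ Nat.nth Nat.Prime i := fun h =>
        hji (Nat.nth_injective Nat.infinite_setOfPred_prime h)
      simp [this, hji]
  rw [Finset.sum_congr rfl this]
  simp

theorem code_inj_s4 {l₁ l₂ : List ℕ} (h : code l₁ = code l₂) : l₁ = l₂ := by
  have hf : ∀ i, (if i < l₁.length then l₁.getD i 0 + 1 else 0) =
      if i < l₂.length then l₂.getD i 0 + 1 else 0 := by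
    intro i; rw [← code_fact, ← code_fact, h]
  have hl : l₁.length = l₂.length := by
    have h1 := hf l₁.length
    have h2 := hf l₂.length
    simp only [lt_irrefl, if_false] at h1 h2
    split_ifs at h1 h2 <;> omega
  apply List.ext_getElem hl
  intro i h1 h2
  have := hf i
  simpa [h1, h2] using this

theorem code_inj_iff (l₁ l₂ : List ℕ) : code l₁ = code l₂ ↔ l₁ = l₂ :=
  ⟨code_inj_s4, fun h => by rw [h]⟩

/-- Inductive version of `Comp`. -/
inductive CI (Sb0 : ℕ → ℕ → ℕ) : ℕ → List ℕ → ℕ → Prop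
  | const (e k n : ℕ) (m : List ℕ) (he : e = code [0, k, 0, n]) : CI Sb0 e m n
  | proj (e k i x : ℕ) (m : List ℕ) (he : e = code [0, k, 1, i]) (hx : x = m.getD i 0) :
      CI Sb0 e m x
  | succ (e k i x : ℕ) (m : List ℕ) (he : e = code [0, k, 2, i]) (hx : x = m.getD i 0 + 1) :
      CI Sb0 e m x
  | eqq (e k p q r s x : ℕ) (m a : List ℕ) (he : e = code [0, k + 3, 4])
      (ha : a = p :: q :: r :: s :: m) (hx : x = if r = s then p else q) : CI Sb0 e a x
  | sb (e k p q x : ℕ) (m a : List ℕ) (he : e = code [0, k + 2, 5])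
      (ha : a = p :: q :: m) (hx : x = Sb0 p q) : CI Sb0 e a x
  | comp (e k b n : ℕ) (m c q : List ℕ) (he : e = code ([1, k, b] ++ c))
      (hq : q.length = c.length)
      (h1 : ∀ i < c.length, CI Sb0 (c.getD i 0) m (q.getD i 0))
      (h2 : CI Sb0 b q n) : CI Sb0 e m n
  | univ (e k b n : ℕ) (m a : List ℕ) (he : e = code [2, k + 1]) (ha : a = b :: m)
      (h : CI Sb0 b m n) : CI Sb0 e a n
  | mu0 (e k b x : ℕ) (m : List ℕ) (f : ℕ → ℕ) (he : e = code [3, k, b]) (hx : x = 0)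
      (hf : ∀ p, 0 < f p) (h : ∀ p, CI Sb0 b (p :: m) (f p)) : CI Sb0 e m x
  | mu1 (e k b p x y : ℕ) (m : List ℕ) (f : ℕ → ℕ) (he : e = code [3, k, b]) (hx : x = p + 1)
      (hy : y = 0) (h0 : CI Sb0 b (p :: m) y)
      (hf : ∀ i < p, 0 < f i) (h : ∀ i < p, CI Sb0 b (i :: m) (f i)) : CI Sb0 e m x

theorem CI_fun {Sb0 : ℕ → ℕ → ℕ} {e : ℕ} {m : List ℕ} {n : ℕ} (h : CI Sb0 e m n) :
    ∀ n', CI Sb0 e m n' → n = n' := by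
  induction h with
  | const e k n m he =>
    intro n' h'
    cases h' <;> simp_all [code_inj_iff]
  | proj e k i x m he hx =>
    intro n' h'
    cases h' <;> simp_all [code_inj_iff]
  | succ e k i x m he hx =>
    intro n' h'
    cases h' <;> simp_all [code_inj_iff]
  | eqq e k p q r s x m a he ha hx =>
    intro n' h'
    cases h' <;> simp_all [code_inj_iff]
  | sb e k p q x m a he ha hx =>
    intro n' h'
    cases h' <;> simp_all [code_inj_iff]
  | comp e k b n m c q he hq h1 h2 ih1 ih2 =>
    intro n' h'
    cases h' with
    | comp _ k' b' _ _ c' q' he' hq' h1' h2' =>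
      have := code_inj_s4 (he.symm.trans he')
      simp only [List.cons_append, List.nil_append, List.cons.injEq] at this
      obtain ⟨_, _, rfl, rfl⟩ := this
      have hqq : q = q' := by
        apply List.ext_getElem (hq.trans hq'.symm)
        intro i hi hi'
        have := ih1 i (by omega) _ (h1' i (by omega))
        simpa [hi, hi'] using this
      subst hqq
      exact ih2 _ h2'
    | _ => simp_all [code_inj_iff]
  | univ e k b n m a he ha h ih =>
    intro n' h'
    cases h' with
    | univ _ k' b' _ m' _ he' ha' h'' =>
      rw [ha] at ha'
      simp only [List.cons.injEq] at ha'
      obtain ⟨rfl, rfl⟩ := ha'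
      exact ih _ h''
    | _ => simp_all [code_inj_iff]
  | mu0 e k b x m f he hx hf h ih =>
    intro n' h'
    cases h' with
    | mu0 _ k' b' _ _ f' he' hx' hf' h' => rw [hx, hx']
    | mu1 _ k' b' p' _ y' _ f' he' hx' hy' h0' hf' h' =>
      have := code_inj_s4 (he.symm.trans he')
      simp only [List.cons.injEq] at this
      obtain ⟨_, _, rfl, _⟩ := this
      have h1 := ih p' _ h0'
      have h2 := hf p'
      omega
    | _ => simp_all [code_inj_iff]
  | mu1 e k b p x y m f he hx hy h0 hf h ih0 ih =>
    intro n' h'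
    cases h' with
    | mu0 _ k' b' _ _ f' he' hx' hf' h' =>
      have := code_inj_s4 (he.symm.trans he')
      simp only [List.cons.injEq] at this
      obtain ⟨_, _, rfl, _⟩ := this
      have h1 := ih0 _ (h' p)
      have h2 := hf' p
      omega
    | mu1 _ k' b' p' _ y' _ f' he' hx' hy' h0' hf' h' =>
      have := code_inj_s4 (he.symm.trans he')
      simp only [List.cons.injEq] at this
      obtain ⟨_, _, rfl, _⟩ := this
      rcases lt_trichotomy p p' with hlt | heq | hlt
      · have h1 := ih0 _ (h' p hlt)
        have h2 := hf' p hlt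
        omega
      · omega
      · have h1 := ih p' hlt _ h0'
        have h2 := hf p' hlt
        omega
    | _ => simp_all [code_inj_iff]

theorem CI_closed (Sb0 : ℕ → ℕ → ℕ) :
    CompClosed Sb0 {u | ∃ e m n, u = code (e :: m ++ [n]) ∧ CI Sb0 e m n} := by
  have key : ∀ e m n, code (e :: m ++ [n]) ∈
      {u | ∃ e m n, u = code (e :: m ++ [n]) ∧ CI Sb0 e m n} ↔ CI Sb0 e m n := by
    intro e m n
    constructor
    · rintro ⟨e', m', n', h, hc⟩
      have := code_inj_s4 h
      simp only [List.cons_append, List.cons.injEq] at this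
      obtain ⟨rfl, h2⟩ := this
      obtain ⟨rfl, h3⟩ := List.append_inj' h2 rfl
      simp only [List.cons.injEq, and_true] at h3
      subst h3
      exact hc
    · intro h
      exact ⟨e, m, n, rfl, h⟩
  refine ⟨?_, ?_, ?_, ?_, ?_, ?_, ?_, ?_, ?_, ?_⟩
  · intro k n m _
    exact (key _ _ _).2 (.const _ k n m rfl)
  · intro k i m _ _
    exact (key _ _ _).2 (.proj _ k i _ m rfl rfl)
  · intro k i m _ _
    exact (key _ _ _).2 (.succ _ k i _ m rfl rfl)
  · intro k p q r s m _ hrs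
    exact (key _ (p :: q :: r :: s :: m) _).2 (.eqq _ k p q r s _ m _ rfl rfl (by simp [hrs]))
  · intro k p q r s m _ hrs
    exact (key _ (p :: q :: r :: s :: m) _).2 (.eqq _ k p q r s _ m _ rfl rfl (by simp [hrs]))
  · intro k p q m _
    exact (key _ (p :: q :: m) _).2 (.sb _ k p q _ m _ rfl rfl rfl)
  · intro k k' b n m c q _ hc hq h1 h2
    subst hc
    exact (key _ _ _).2 (.comp _ k b n m c q rfl hq
      (fun i hi => (key _ _ _).1 (h1 i hi)) ((key _ _ _).1 h2))
  · intro k b n m _ h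
    exact (key _ (b :: m) _).2 (.univ _ k b n m _ rfl rfl ((key _ _ _).1 h))
  · intro k b m _ h
    choose f hf h using h
    exact (key _ _ _).2 (.mu0 _ k b _ m f rfl rfl hf (fun p => (key _ (p :: m) _).1 (h p)))
  · intro k b p m _ h0 h
    choose! f h using h
    exact (key _ _ _).2 (.mu1 _ k b p _ _ m f rfl rfl rfl ((key _ (p :: m) _).1 h0)
      (fun i hi => (h i hi).1) (fun i hi => (key _ (i :: m) _).1 (h i hi).2))

theorem app_fun {Sb0 : ℕ → ℕ → ℕ} {e k x y : ℕ} (hx : app Sb0 e k x) (hy : app Sb0 e k y) :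
    x = y := by
  have aux : ∀ z, app Sb0 e k z → CI Sb0 e [k] z := by
    intro z hz
    obtain ⟨e', m', n', h, hc⟩ := hz _ (CI_closed Sb0)
    have := code_inj_s4 h
    simp only [List.cons_append, List.cons.injEq] at this
    obtain ⟨rfl, h2⟩ := this
    have h2' : [k] ++ [z] = m' ++ [n'] := h2
    obtain ⟨rfl, h3⟩ := List.append_inj' h2' rfl
    simp only [List.cons.injEq, and_true] at h3
    subst h3
    exact hc
  exact CI_fun (aux x hx) y (aux y hy)

/-- The least family. -/
def leastFam (Sb0 : ℕ → ℕ → ℕ) : TyFam := ⟨UU Sb0, EE Sb0, NEE Sb0, VV Sb0⟩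

theorem leastFam_closed (Sb0 : ℕ → ℕ → ℕ) : TyClosed Sb0 (leastFam Sb0) := by
  refine ⟨?_, ?_, ?_, ?_, ?_, ?_, ?_, ?_, ?_, ?_, ?_, ?_, ?_, ?_, ?_, ?_, ?_, ?_, ?_, ?_, ?_⟩
  · intro n F hF; exact hF.1 n
  · intro k n h F hF; exact hF.2.1 k n h
  · intro k n h F hF; exact hF.2.2.1 k n h
  · intro F hF; exact hF.2.2.2.1
  · intro n F hF; exact hF.2.2.2.2.1 n
  · intro n m h1 h2 F hF; exact hF.2.2.2.2.2.1 n m (h1 F hF) (h2 F hF)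
  · intro n m k h1 h2 F hF; exact hF.2.2.2.2.2.2.1 n m k (h1 F hF) (h2 F hF)
  · intro n m k h1 h2 F hF; exact hF.2.2.2.2.2.2.2.1 n m k (h1 F hF) (h2 F hF)
  · intro n m k h1 h2 F hF; exact hF.2.2.2.2.2.2.2.2.1 n m k (h1 F hF) (h2 F hF)
  · intro n m k h1 h2 F hF; exact hF.2.2.2.2.2.2.2.2.2.1 n m k (h1 F hF) (h2 F hF)
  · intro n m k h1 h2 F hF; exact hF.2.2.2.2.2.2.2.2.2.2.1 n m k (h1 F hF) h2
  · intro n e h1 h2 F hF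
    exact hF.2.2.2.2.2.2.2.2.2.2.2.1 n e (h1 F hF)
      (fun k => (h2 k).imp (fun h => h F hF) (fun ⟨x, h, h'⟩ => ⟨x, h, h' F hF⟩))
  · intro n e k u x h1 h2 h3 h4 F hF
    exact hF.2.2.2.2.2.2.2.2.2.2.2.2.1 n e k u x (h1 F hF) (h2 F hF) h3 (h4 F hF)
  · intro n e k u h1 h2 F hF
    exact hF.2.2.2.2.2.2.2.2.2.2.2.2.2.1 n e k u (h1 F hF) (h2 F hF)
  · intro n e k u x h1 h2 h3 F hF
    exact hF.2.2.2.2.2.2.2.2.2.2.2.2.2.2.1 n e k u x (h1 F hF) h2 (h3 F hF)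
  · intro n e z h1 h2 F hF
    exact hF.2.2.2.2.2.2.2.2.2.2.2.2.2.2.2.1 n e z (h1 F hF) h2
  · intro n e h1 h2 F hF
    exact hF.2.2.2.2.2.2.2.2.2.2.2.2.2.2.2.2.1 n e (h1 F hF)
      (fun k => (h2 k).imp (fun h => h F hF) (fun ⟨x, h, h'⟩ => ⟨x, h, h' F hF⟩))
  · intro n e d h1 h2 F hF
    exact hF.2.2.2.2.2.2.2.2.2.2.2.2.2.2.2.2.2.1 n e d (h1 F hF)
      (fun k => (h2 k).imp (fun h => h F hF) (fun ⟨x, y, h, h', h''⟩ => ⟨x, y, h, h', h'' F hF⟩))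
  · intro n e d u h1 h2 h3 F hF
    exact hF.2.2.2.2.2.2.2.2.2.2.2.2.2.2.2.2.2.2.1 n e d u (h1 F hF) (h2 F hF) h3
  · intro n e d u x z h1 h2 h3 h4 h5 F hF
    exact hF.2.2.2.2.2.2.2.2.2.2.2.2.2.2.2.2.2.2.2.1 n e d u x z (h1 F hF) (h2 F hF) h3 h4
      (h5 F hF)
  · intro n e h1 h2 F hF
    exact hF.2.2.2.2.2.2.2.2.2.2.2.2.2.2.2.2.2.2.2.2 n e (h1 F hF)
      (fun k => (h2 k).imp (fun h => h F hF) (fun ⟨x, h, h'⟩ => ⟨x, h, h' F hF⟩))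

/-- Inversion property for elementhood. -/
def InvE (Sb0 : ℕ → ℕ → ℕ) (k n : ℕ) : Prop :=
  (∀ a, n = nNat a → k < a) ∧
  (∀ a b, n = plT a b → (∃ j, k = pair 0 j ∧ EE Sb0 j a) ∨ (∃ j, k = pair 1 j ∧ EE Sb0 j b)) ∧
  (∀ a e, n = sigT a e → ∃ j u x, k = pair j u ∧ EE Sb0 j a ∧ app Sb0 e j x ∧ EE Sb0 u x) ∧
  (∀ a e, n = piT a e → ∀ j, NEE Sb0 j a ∨
    ∃ x y, app Sb0 e j x ∧ app Sb0 k j y ∧ EE Sb0 y x)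

/-- Inversion property for non-elementhood. -/
def InvNE (Sb0 : ℕ → ℕ → ℕ) (k n : ℕ) : Prop :=
  (∀ a, n = nNat a → a ≤ k) ∧
  n ≠ natt ∧
  (∀ a b, n = plT a b → (∃ j, k = pair 0 j ∧ NEE Sb0 j a) ∨ (∃ j, k = pair 1 j ∧ NEE Sb0 j b) ∨
    (∀ x, k ≠ pair 0 x ∧ k ≠ pair 1 x)) ∧
  (∀ a e, n = sigT a e → (∃ j u, k = pair j u ∧ NEE Sb0 j a) ∨
    (∃ j u x, k = pair j u ∧ app Sb0 e j x ∧ NEE Sb0 u x) ∨ (∀ u v, k ≠ pair u v)) ∧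
  (∀ a e, n = piT a e → ∃ u, EE Sb0 u a ∧ ((∀ z, ¬ app Sb0 k u z) ∨
    ∃ x z, app Sb0 e u x ∧ app Sb0 k u z ∧ NEE Sb0 z x))

theorem invFam_closed (Sb0 : ℕ → ℕ → ℕ) : TyClosed Sb0
    ⟨UU Sb0, fun k n => EE Sb0 k n ∧ InvE Sb0 k n, fun k n => NEE Sb0 k n ∧ InvNE Sb0 k n,
      VV Sb0⟩ := by
  obtain ⟨c1, c2, c3, c4, c5, c6, c7, c8, c9, c10, c11, c12, c13, c14, c15, c16, c17, c18, c19,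
    c20, c21⟩ := leastFam_closed Sb0
  refine ⟨c1, ?_, ?_, c4, ?_, c6, ?_, ?_, ?_, ?_, ?_, ?_, ?_, ?_, ?_, ?_, ?_, ?_, ?_, ?_, ?_⟩
  · intro k n h
    refine ⟨c2 k n h, ?_⟩
    simp [InvE, nNat, plT, sigT, piT, pair_inj_iff, h]
  · intro k n h
    refine ⟨c3 k n h, ?_⟩
    simp [InvNE, nNat, natt, plT, sigT, piT, pair_inj_iff, h]
  · intro n
    refine ⟨c5 n, ?_⟩
    simp [InvE, natt, nNat, plT, sigT, piT, pair_inj_iff]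
  · intro n m k h1 h2
    refine ⟨c7 n m k h1 h2.1, ?_⟩
    have := h2.1
    simp [InvE, natt, nNat, plT, sigT, piT, pair_inj_iff]
    exact this
  · intro n m k h1 h2
    refine ⟨c8 n m k h1 h2.1, ?_⟩
    have := h2.1
    simp [InvE, natt, nNat, plT, sigT, piT, pair_inj_iff]
    exact this
  · intro n m k h1 h2
    refine ⟨c9 n m k h1 h2.1, ?_⟩
    have := h2.1
    simp [InvNE, natt, nNat, plT, sigT, piT, pair_inj_iff]
    exact this
  · intro n m k h1 h2
    refine ⟨c10 n m k h1 h2.1, ?_⟩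
    have := h2.1
    simp [InvNE, natt, nNat, plT, sigT, piT, pair_inj_iff]
    exact this
  · intro n m k h1 h2
    refine ⟨c11 n m k h1 h2, ?_⟩
    refine ⟨?_, ?_, fun a b _ => .inr (.inr h2), ?_, ?_⟩ <;>
      simp [natt, nNat, plT, sigT, piT, pair_inj_iff]
  · intro n e h1 h2
    exact c12 n e h1 (fun k => (h2 k).imp (fun h => h.1) id)
  · intro n e k u x h1 h2 h3 h4
    refine ⟨c13 n e k u x h1 h2.1 h3 h4.1, ?_⟩
    refine ⟨?_, ?_, ?_, ?_⟩
    rotate_left 2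
    · intro a e' h
      simp only [sigT, pair_inj_iff, true_and] at h
      obtain ⟨rfl, rfl⟩ := h
      exact ⟨k, u, x, rfl, h2.1, h3, h4.1⟩
    all_goals simp [natt, nNat, plT, sigT, piT, pair_inj_iff]
  · intro n e k u h1 h2
    refine ⟨c14 n e k u h1 h2.1, ?_⟩
    refine ⟨?_, ?_, ?_, ?_, ?_⟩
    rotate_left 3
    · intro a e' h
      simp only [sigT, pair_inj_iff, true_and] at h
      obtain ⟨rfl, rfl⟩ := h
      exact .inl ⟨k, u, rfl, h2.1⟩
    all_goals simp [natt, nNat, plT, sigT, piT, pair_inj_iff]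
  · intro n e k u x h1 h2 h3
    refine ⟨c15 n e k u x h1 h2 h3.1, ?_⟩
    refine ⟨?_, ?_, ?_, ?_, ?_⟩
    rotate_left 3
    · intro a e' h
      simp only [sigT, pair_inj_iff, true_and] at h
      obtain ⟨rfl, rfl⟩ := h
      exact .inr (.inl ⟨k, u, x, rfl, h2, h3.1⟩)
    all_goals simp [natt, nNat, plT, sigT, piT, pair_inj_iff]
  · intro n e z h1 h2
    refine ⟨c16 n e z h1 h2, ?_⟩
    refine ⟨?_, ?_, ?_, fun _ _ _ => .inr (.inr h2), ?_⟩
    all_goals simp [natt, nNat, plT, sigT, piT, pair_inj_iff]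
  · intro n e h1 h2
    exact c17 n e h1 (fun k => (h2 k).imp (fun h => h.1) id)
  · intro n e d h1 h2
    have h2' : ∀ k : ℕ, NEE Sb0 k n ∨ ∃ x y : ℕ, app Sb0 e k x ∧ app Sb0 d k y ∧ EE Sb0 y x :=
      fun k => (h2 k).imp (fun h => h.1) (fun ⟨x, y, h, h', h''⟩ => ⟨x, y, h, h', h''.1⟩)
    refine ⟨c18 n e d h1 h2', ?_⟩
    refine ⟨?_, ?_, ?_, ?_⟩
    rotate_left 3
    · intro a e' h
      simp only [piT, pair_inj_iff, true_and] at h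
      obtain ⟨rfl, rfl⟩ := h
      exact h2'
    all_goals simp [natt, nNat, plT, sigT, piT, pair_inj_iff]
  · intro n e d u h1 h2 h3
    refine ⟨c19 n e d u h1 h2.1 h3, ?_⟩
    refine ⟨?_, ?_, ?_, ?_, ?_⟩
    rotate_left 4
    · intro a e' h
      simp only [piT, pair_inj_iff, true_and] at h
      obtain ⟨rfl, rfl⟩ := h
      exact ⟨u, h2.1, .inl h3⟩
    all_goals simp [natt, nNat, plT, sigT, piT, pair_inj_iff]
  · intro n e d u x z h1 h2 h3 h4 h5
    refine ⟨c20 n e d u x z h1 h2.1 h3 h4 h5.1, ?_⟩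
    refine ⟨?_, ?_, ?_, ?_, ?_⟩
    rotate_left 4
    · intro a e' h
      simp only [piT, pair_inj_iff, true_and] at h
      obtain ⟨rfl, rfl⟩ := h
      exact ⟨u, h2.1, .inr ⟨x, z, h3, h4, h5.1⟩⟩
    all_goals simp [natt, nNat, plT, sigT, piT, pair_inj_iff]
  · intro n e h1 h2
    exact c21 n e h1 (fun k => (h2 k).imp (fun h => h.1) id)

theorem EE.inv {Sb0 : ℕ → ℕ → ℕ} {k n : ℕ} (h : EE Sb0 k n) : InvE Sb0 k n :=
  (h _ (invFam_closed Sb0)).2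

theorem NEE.inv {Sb0 : ℕ → ℕ → ℕ} {k n : ℕ} (h : NEE Sb0 k n) : InvNE Sb0 k n :=
  (h _ (invFam_closed Sb0)).2

theorem compl_closed (Sb0 : ℕ → ℕ → ℕ) : TyClosed Sb0
    ⟨fun n => UU Sb0 n ∧ ∀ x, EE Sb0 x n ↔ ¬ NEE Sb0 x n, EE Sb0, NEE Sb0, VV Sb0⟩ := by
  obtain ⟨c1, c2, c3, c4, c5, c6, c7, c8, c9, c10, c11, c12, c13, c14, c15, c16, c17, c18, c19,
    c20, c21⟩ := leastFam_closed Sb0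
  refine ⟨?_, c2, c3, ?_, c5, ?_, fun n m k h => c7 n m k h.1, fun n m k h => c8 n m k h.1,
    fun n m k h => c9 n m k h.1, fun n m k h => c10 n m k h.1, fun n m k h => c11 n m k h.1, ?_,
    fun n e k u x h => c13 n e k u x h.1, fun n e k u h => c14 n e k u h.1,
    fun n e k u x h => c15 n e k u x h.1, fun n e z h => c16 n e z h.1, ?_,
    fun n e d h => c18 n e d h.1, fun n e d u h => c19 n e d u h.1,
    fun n e d u x z h => c20 n e d u x z h.1, fun n e h => c21 n e h.1⟩
  · intro n
    refine ⟨c1 n, fun x => ⟨fun h h' => ?_, fun h => ?_⟩⟩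
    · have h1 := h.inv.1 n rfl
      have h2 := h'.inv.1 n rfl
      omega
    · by_contra hc
      rcases lt_or_ge x n with hlt | hge
      · exact hc (c2 x n hlt)
      · exact h (c3 x n hge)
  · exact ⟨c4, fun x => ⟨fun _ h' => h'.inv.2.1 rfl, fun _ => c5 x⟩⟩
  · intro n m hn hm
    have hU := c6 n m hn.1 hm.1
    refine ⟨hU, fun x => ⟨fun h h' => ?_, fun h => ?_⟩⟩
    · rcases h.inv.2.1 n m rfl with ⟨j, rfl, hj⟩ | ⟨j, rfl, hj⟩
      · rcases h'.inv.2.2.1 n m rfl with ⟨i, hi, hi'⟩ | ⟨i, hi, hi'⟩ | hi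
        · obtain rfl := ((pair_inj_iff _ _ _ _).1 hi).2
          exact (hn.2 _).1 hj hi'
        · simp [pair_inj_iff] at hi
        · exact (hi j).1 rfl
      · rcases h'.inv.2.2.1 n m rfl with ⟨i, hi, hi'⟩ | ⟨i, hi, hi'⟩ | hi
        · simp [pair_inj_iff] at hi
        · obtain rfl := ((pair_inj_iff _ _ _ _).1 hi).2
          exact (hm.2 _).1 hj hi'
        · exact (hi j).2 rfl
    · by_cases h0 : ∃ j, x = pair 0 j
      · obtain ⟨j, rfl⟩ := h0
        exact c7 n m j hU ((hn.2 j).2 fun h' => h (c9 n m j hU h'))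
      · by_cases h1 : ∃ j, x = pair 1 j
        · obtain ⟨j, rfl⟩ := h1
          exact c8 n m j hU ((hm.2 j).2 fun h' => h (c10 n m j hU h'))
        · exact absurd (c11 n m x hU fun j => ⟨fun e => h0 ⟨j, e⟩, fun e => h1 ⟨j, e⟩⟩) h
  · intro n e hn he
    have hU := c12 n e hn.1 (fun k => (he k).imp id (fun ⟨x, h, h'⟩ => ⟨x, h, h'.1⟩))
    refine ⟨hU, fun z => ⟨fun h h' => ?_, fun h => ?_⟩⟩
    · obtain ⟨j, u, x, rfl, hj, hx, hu⟩ := h.inv.2.2.1 n e rfl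
      have hj' := (hn.2 j).1 hj
      obtain ⟨x', hx', hUx⟩ := (he j).resolve_left hj'
      obtain rfl := app_fun hx hx'
      rcases h'.inv.2.2.2.1 n e rfl with ⟨i, v, hi, hi'⟩ | ⟨i, v, y, hi, hy, hi'⟩ | hi
      · obtain ⟨rfl, rfl⟩ := (pair_inj_iff _ _ _ _).1 hi
        exact hj' hi'
      · obtain ⟨rfl, rfl⟩ := (pair_inj_iff _ _ _ _).1 hi
        obtain rfl := app_fun hx hy
        exact (hUx.2 _).1 hu hi'
      · exact hi _ _ rfl
    · by_cases h0 : ∃ j u, z = pair j u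
      · obtain ⟨j, u, rfl⟩ := h0
        have hj : ¬ NEE Sb0 j n := fun h' => h (c14 n e j u hU h')
        obtain ⟨x, hx, hUx⟩ := (he j).resolve_left hj
        exact c13 n e j u x hU ((hn.2 j).2 hj) hx
          ((hUx.2 u).2 fun h' => h (c15 n e j u x hU hx h'))
      · exact absurd (c16 n e z hU fun u v e => h0 ⟨u, v, e⟩) h
  · intro n e hn he
    have hU := c17 n e hn.1 (fun k => (he k).imp id (fun ⟨x, h, h'⟩ => ⟨x, h, h'.1⟩))
    refine ⟨hU, fun d => ⟨fun h h' => ?_, fun h => ?_⟩⟩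
    · obtain ⟨u, hu, h2⟩ := h'.inv.2.2.2.2 n e rfl
      have hu' := (hn.2 u).1 hu
      obtain ⟨x, y, hx, hy, hyx⟩ := (h.inv.2.2.2 n e rfl u).resolve_left hu'
      obtain ⟨x', hx', hUx⟩ := (he u).resolve_left hu'
      obtain rfl := app_fun hx hx'
      rcases h2 with h2 | ⟨x', z, hx', hz, hzx⟩
      · exact h2 y hy
      · obtain rfl := app_fun hx hx'
        obtain rfl := app_fun hy hz
        exact (hUx.2 _).1 hyx hzx
    · refine c18 n e d hU fun k => ?_
      by_cases hk : NEE Sb0 k n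
      · exact .inl hk
      · right
        have hk' := (hn.2 k).2 hk
        obtain ⟨x, hx, hUx⟩ := (he k).resolve_left hk
        by_cases hz : ∃ z, app Sb0 d k z
        · obtain ⟨z, hz⟩ := hz
          exact ⟨x, z, hx, hz, (hUx.2 z).2 fun h' => h (c20 n e d k x z hU hk' hx hz h')⟩
        · exact absurd (c19 n e d k hU hk' fun z h' => hz ⟨z, h'⟩) h

/-- Lemma 5.3: for every type `n ∈ U`, elementhood and non-elementhood are
complementary: `x E n` holds iff `x NE n` fails. -/
theorem elem_iff_not_nonelem (Sb0 : ℕ → ℕ → ℕ) (n : ℕ) (hn : UU Sb0 n) :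
    ∀ x : ℕ, EE Sb0 x n ↔ ¬ NEE Sb0 x n := by
  exact (hn _ (compl_closed Sb0)).2
end
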